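/- Spine image claim: Let T ⊂ ℝ² be the tripod, i.e. the union of the three straight segments joining the origin o to the points (1,0), (−1/2, √3/2), (−1/2, −√3/2). Let (Uᵢ)_{i ∈ ℕ} be a countable family of nonempty open round disks in S² whose closures are pairwise disjoint and whose union is dense in S², and set I* := S² \ ⋃ᵢ Uᵢ. Let g : T × [0,1] → S² be a continuous map that is injective on g⁻¹(I*), and suppose there exists s ∈ (0,1) with g(o, s) ∈ S² \ ⋃ᵢ closure(Uᵢ). Then the image of the open spine is contained in I*, i.e. g({o} × (0,1)) ⊆ I*. -/

import Mathlib

open Metric Set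

noncomputable section

/-- The unit sphere in Euclidean 3-space, as a metric space with the metric induced from ℝ³. -/
abbrev Sph : Type := (Metric.sphere (0 : EuclideanSpace ℝ (Fin 3)) 1 : Set (EuclideanSpace ℝ (Fin 3)))

/-- The tripod `T ⊂ ℝ²`: the union of the three straight segments joining the origin to
`(1,0)`, `(-1/2, √3/2)` and `(-1/2, -√3/2)`. -/
def tripod : Set (ℝ × ℝ) :=
  segment ℝ (0 : ℝ × ℝ) (1, 0) ∪ segment ℝ (0 : ℝ × ℝ) (-(1/2), Real.sqrt 3 / 2) ∪
    segment ℝ (0 : ℝ × ℝ) (-(1/2), -(Real.sqrt 3 / 2))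

abbrev E3 : Type := EuclideanSpace ℝ (Fin 3)

lemma sph_norm (y : Sph) : ‖(y : E3)‖ = 1 := by simpa using y.2

lemma sph_dist_sq (y c : Sph) : dist y c ^ 2 = 2 - 2 * inner ℝ (c : E3) (y : E3) := by
  rw [Subtype.dist_eq, dist_eq_norm, norm_sub_sq_real, sph_norm, sph_norm, real_inner_comm]
  ring

lemma proj_norm_sq (c y : Sph) :
    ‖(y : E3) - (inner ℝ (c : E3) (y : E3)) • (c : E3)‖ ^ 2 = 1 - (inner ℝ (c : E3) (y : E3)) ^ 2 := by
  rw [norm_sub_sq_real, norm_smul, sph_norm, sph_norm, inner_smul_right, real_inner_comm,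
    Real.norm_eq_abs, mul_pow, sq_abs]
  ring

lemma proj_inner (c y : Sph) :
    inner ℝ (c : E3) ((y : E3) - (inner ℝ (c : E3) (y : E3)) • (c : E3)) = 0 := by
  rw [inner_sub_right, inner_smul_right, real_inner_self_eq_norm_sq, sph_norm]
  ring

lemma circle_param (c z : Sph) : ∃ (γ : ℝ → E3) (θ : Sph → ℝ), ContDiff ℝ 1 γ ∧
    (∀ t, ∃ y : Sph, (y : E3) = γ t ∧ dist y c = dist z c) ∧
    (∀ y : Sph, dist y c = dist z c → γ (θ y) = y) ∧
    ContinuousOn θ ({y | dist y c = dist z c} \ {z}) := by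
  set τ : ℝ := inner ℝ (c : E3) (z : E3) with hτ
  have hdist : ∀ y : Sph, dist y c = dist z c ↔ inner ℝ (c : E3) (y : E3) = τ := by
    intro y
    rw [← sq_eq_sq₀ dist_nonneg dist_nonneg, sph_dist_sq, sph_dist_sq]
    constructor <;> intro h <;> linarith
  set ρ : ℝ := ‖(z : E3) - τ • (c : E3)‖ with hρ
  have hρ2 : ρ ^ 2 = 1 - τ ^ 2 := proj_norm_sq c z
  rcases eq_or_ne ρ 0 with h0 | h0
  · have hz : ∀ y : Sph, dist y c = dist z c → y = z := by
      intro y hy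
      have h1 := proj_norm_sq c y
      rw [(hdist y).1 hy, ← hρ2, h0] at h1
      have h2 : (y : E3) - τ • (c : E3) = 0 := by simpa using h1
      have h3 : (z : E3) - τ • (c : E3) = 0 := norm_eq_zero.1 h0
      exact Subtype.ext (by rw [sub_eq_zero.1 h2, sub_eq_zero.1 h3])
    refine ⟨fun _ => z, fun _ => 0, contDiff_const, fun t => ⟨z, rfl, rfl⟩, fun y hy => ?_,
      continuousOn_const⟩
    rw [hz y hy]
  have hρpos : 0 < ρ := lt_of_le_of_ne (norm_nonneg _) h0.symm
  set e1 : E3 := (-ρ⁻¹) • ((z : E3) - τ • (c : E3)) with he1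
  have hce : inner ℝ (c : E3) e1 = 0 := by
    rw [he1, inner_smul_right, proj_inner]; simp
  have hee : ‖e1‖ = 1 := by
    rw [he1, norm_smul, ← hρ, norm_neg, norm_inv, Real.norm_of_nonneg hρpos.le]
    exact inv_mul_cancel₀ h0
  obtain ⟨b, hb⟩ := Orthonormal.exists_orthonormalBasis_extension_of_card_eq (𝕜 := ℝ) (E := E3)
    (ι := Fin 3) (by simp) (v := ![(c : E3), e1, 0]) (s := {0, 1}) (by
      rw [orthonormal_iff_ite]
      rintro ⟨i, hi⟩ ⟨j, hj⟩
      have hce' : inner ℝ e1 (c : E3) = 0 := by rw [real_inner_comm]; exact hce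
      rcases hi with rfl | rfl <;> rcases hj with rfl | rfl <;>
        simp [hce, hce', hee, Subtype.ext_iff])
  have hb0 : b 0 = c := hb 0 (by simp)
  have hb1 : b 1 = e1 := hb 1 (by simp)
  have hexp : ∀ y : E3, y = inner ℝ (b 0) y • b 0 + inner ℝ (b 1) y • b 1 + inner ℝ (b 2) y • b 2 := by
    intro y
    have := b.sum_repr' y
    rw [Fin.sum_univ_three] at this
    exact this.symm
  have hns : ∀ x0 x1 x2 : ℝ, ‖x0 • b 0 + x1 • b 1 + x2 • b 2‖ ^ 2 = x0 ^ 2 + x1 ^ 2 + x2 ^ 2 := by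
    intro x0 x1 x2
    have h := b.orthonormal
    have h01 := h.inner_eq_zero (i := 0) (j := 1) (by decide)
    have h02 := h.inner_eq_zero (i := 0) (j := 2) (by decide)
    have h12 := h.inner_eq_zero (i := 1) (j := 2) (by decide)
    rw [norm_add_sq_real, norm_add_sq_real]
    simp only [norm_smul, h.norm_eq_one, inner_add_left, inner_smul_left, inner_smul_right, h01, h02, h12,
      Real.norm_eq_abs, mul_pow, sq_abs]
    simp
  let γ : ℝ → E3 := fun t => τ • b 0 + (ρ * Real.cos t) • b 1 + (ρ * Real.sin t) • b 2
  let w : Sph → ℂ := fun y => ⟨inner ℝ (b 1) (y : E3), inner ℝ (b 2) (y : E3)⟩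
  have hwc : Continuous w := by
    have : w = fun y : Sph => ((inner ℝ (b 1) (y : E3) : ℝ) : ℂ) + ((inner ℝ (b 2) (y : E3) : ℝ) : ℂ) * Complex.I := by
      funext y; apply Complex.ext <;> simp [w]
    rw [this]; fun_prop
  have hwn : ∀ y : Sph, dist y c = dist z c → ‖w y‖ = ρ := by
    intro y hy
    rw [← sq_eq_sq₀ (norm_nonneg _) hρpos.le, hρ2, Complex.sq_norm, Complex.normSq_apply]
    have h1 : ‖(y : E3)‖ ^ 2 = 1 := by rw [sph_norm]; norm_num
    rw [hexp y, hns, hb0, (hdist y).1 hy] at h1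
    simp only [w]
    rw [← hb1] at *
    linarith
  refine ⟨γ, fun y => Complex.arg (w y), by fun_prop, ?_, ?_, ?_⟩
  · intro t
    have hn : ‖γ t‖ = 1 := by
      rw [← sq_eq_sq₀ (norm_nonneg _) zero_le_one, hns]
      nlinarith [Real.sin_sq_add_cos_sq t]
    refine ⟨⟨γ t, by simpa using hn⟩, rfl, ?_⟩
    rw [hdist, ← hb0]
    have h := b.orthonormal
    have h01 := h.inner_eq_zero (i := 0) (j := 1) (by decide)
    have h02 := h.inner_eq_zero (i := 0) (j := 2) (by decide)
    simp only [γ, inner_add_right, inner_smul_right, h01, h02, real_inner_self_eq_norm_sq,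
      h.norm_eq_one]
    simp
  · intro y hy
    conv_rhs => rw [hexp y]
    simp only [γ]
    rw [← hwn y hy, Complex.norm_mul_cos_arg, Complex.norm_mul_sin_arg]
    have := (hdist y).1 hy
    rw [hb0, this]
  · rintro y ⟨hy, hyz⟩
    apply ContinuousAt.continuousWithinAt
    refine ContinuousAt.comp (f := w) (g := Complex.arg) (Complex.continuousAt_arg ?_) hwc.continuousAt
    rw [Complex.mem_slitPlane_iff]
    by_contra hcon
    push Not at hcon
    obtain ⟨hre, him⟩ := hcon
    apply hyz
    have h1 := hwn y hy
    have h2 : (w y).re = -ρ := by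
      have h3 := Complex.sq_norm (w y)
      rw [Complex.normSq_apply, him, h1] at h3
      nlinarith
    apply Subtype.ext
    rw [hexp y]
    have h4 : inner ℝ (b 1) (y : E3) = -ρ := h2
    have h5 : inner ℝ (b 2) (y : E3) = 0 := him
    have h6 := (hdist y).1 hy
    rw [h4, h5, hb0, h6, hb1, he1, smul_smul]
    have : -ρ * -ρ⁻¹ = 1 := by field_simp
    rw [this]; simp

lemma radial_retract (q : Sph) (ε : ℝ) (hε : 0 < ε) (hε2 : ε < 2) :
    ∃ Φ : Sph → Sph, ContinuousOn Φ {q}ᶜ ∧ (∀ y, y ∉ ball q ε → Φ y = y) ∧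
      (∀ y ∈ ball q ε, y ≠ q → dist (Φ y) q = ε) := by
  classical
  set τ : ℝ := 1 - ε ^ 2 / 2 with hτ
  set ρ : ℝ := Real.sqrt (1 - τ ^ 2) with hρ
  have hτ2 : 0 ≤ 1 - τ ^ 2 := by
    have : 1 - τ ^ 2 = ε ^ 2 * (2 - ε) * (2 + ε) / 4 := by rw [hτ]; ring
    rw [this]
    have : 0 ≤ 2 - ε := by linarith
    positivity
  have hρ2 : ρ ^ 2 = 1 - τ ^ 2 := Real.sq_sqrt hτ2
  let π : Sph → E3 := fun y => (y : E3) - (inner ℝ (q : E3) (y : E3)) • (q : E3)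
  have hπ : ∀ y ∈ closedBall q ε, y ≠ q → 0 < ‖π y‖ := by
    intro y hy hyq
    have h1 := proj_norm_sq q y
    have h2 := sph_dist_sq y q
    have h3 : 0 < dist y q := dist_pos.2 hyq
    have h4 : dist y q ≤ ε := hy
    set a : ℝ := inner ℝ (q : E3) (y : E3)
    have h5 : 0 < 1 - a ^ 2 := by
      have : 1 - a ^ 2 = dist y q ^ 2 * (2 - dist y q) * (2 + dist y q) / 4 := by
        have : a = 1 - dist y q ^ 2 / 2 := by linarith
        rw [this]; ring
      rw [this]
      have : 0 < 2 - dist y q := by linarith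
      positivity
    rw [← h1] at h5
    exact lt_of_le_of_ne (norm_nonneg _) (fun h => by simp only [π] at h; rw [← h] at h5; simp at h5)
  let Ψ1 : Sph → E3 := fun y => τ • (q : E3) + (ρ / ‖π y‖) • π y
  have hΨn : ∀ y ∈ closedBall q ε, y ≠ q → ‖Ψ1 y‖ = 1 ∧ inner ℝ (q : E3) (Ψ1 y) = τ := by
    intro y hy hyq
    have h1 := hπ y hy hyq
    have h2 : inner ℝ (q : E3) (π y) = 0 := proj_inner q y
    constructor
    · rw [← sq_eq_sq₀ (norm_nonneg _) zero_le_one, norm_add_sq_real, inner_smul_left,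
        inner_smul_right, h2, norm_smul, norm_smul, sph_norm, mul_pow, mul_pow]
      simp only [Real.norm_eq_abs, sq_abs, div_pow]
      field_simp
      rw [hρ2]; simp; ring
    · simp only [Ψ1]
      rw [inner_add_right, inner_smul_right, inner_smul_right, h2, real_inner_self_eq_norm_sq,
        sph_norm]
      simp
  let Ψ : Sph → E3 := (ball q ε).piecewise Ψ1 (fun y => (y : E3))
  have hπc : Continuous π := by fun_prop
  have hΨc : ContinuousOn Ψ {q}ᶜ := by
    apply ContinuousOn.piecewise
    · rintro y ⟨hyq, hy⟩
      have hd : dist y q = ε := frontier_ball_subset_sphere hy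
      have hcb : y ∈ closedBall q ε := by simp [hd]
      have h1 := hπ y hcb hyq
      have h2 := sph_dist_sq y q
      have h3 : inner ℝ (q : E3) (y : E3) = τ := by rw [hd] at h2; linarith
      have h4 : ‖π y‖ = ρ := by
        rw [← sq_eq_sq₀ (norm_nonneg _) (Real.sqrt_nonneg _), hρ2, ← h3]
        exact proj_norm_sq q y
      simp only [Ψ1]
      rw [h4, div_self (h4 ▸ h1).ne']
      simp only [π]
      rw [h3]; simp
    · have hsub : {q}ᶜ ∩ closure (ball q ε) ⊆ {y | y ∈ closedBall q ε ∧ y ≠ q} :=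
        fun y hy => ⟨closure_ball_subset_closedBall hy.2, hy.1⟩
      refine ContinuousOn.mono ?_ hsub
      apply ContinuousOn.add continuousOn_const
      refine ContinuousOn.smul (f := fun y => ρ / ‖π y‖) (g := π) ?_ hπc.continuousOn
      exact continuousOn_const.div hπc.norm.continuousOn (fun y hy => (hπ y hy.1 hy.2).ne')
    · exact continuous_subtype_val.continuousOn
  have hΨ1 : ∀ y ≠ q, ‖Ψ y‖ = 1 := by
    intro y hy
    by_cases h : y ∈ ball q ε
    · simp only [Ψ, h, piecewise_eq_of_mem]; exact (hΨn y (ball_subset_closedBall h) hy).1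
    · simp only [Ψ, h, not_false_eq_true, piecewise_eq_of_notMem]; exact sph_norm y
  let Φ : Sph → Sph := fun y => if h : ‖Ψ y‖ = 1 then ⟨Ψ y, by simpa using h⟩ else y
  have hΦ : ∀ y ≠ q, (Φ y : E3) = Ψ y := by
    intro y hy
    simp [Φ, hΨ1 y hy]
  refine ⟨Φ, ?_, ?_, ?_⟩
  · rw [Topology.IsInducing.subtypeVal.continuousOn_iff]
    exact hΨc.congr (fun y hy => hΦ y hy)
  · intro y hy
    apply Subtype.ext
    rw [hΦ y (by rintro rfl; exact hy (mem_ball_self hε))]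
    simp [Ψ, hy]
  · intro y hy hyq
    have h1 := (hΨn y (ball_subset_closedBall hy) hyq).2
    rw [← sq_eq_sq₀ dist_nonneg hε.le, sph_dist_sq, hΦ y hyq]
    simp only [Ψ, hy, piecewise_eq_of_mem]
    rw [h1, hτ]; ring

lemma cap_preconnected (q : Sph) (ε : ℝ) (hε : 0 < ε) (hε1 : ε ≤ 1) :
    IsPreconnected (ball q ε : Set Sph) := by
  classical
  set τ : ℝ := 1 - ε ^ 2 / 2 with hτ
  have hτ0 : 0 ≤ τ := by nlinarith
  let C : Set E3 := {v | τ * ‖v‖ < inner ℝ (q : E3) v}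
  have hC : Convex ℝ C := by
    intro u hu v hv a b ha hb hab
    simp only [C, mem_ofPred_eq] at *
    rw [inner_add_right, inner_smul_right, inner_smul_right]
    have h1 : ‖a • u + b • v‖ ≤ a * ‖u‖ + b * ‖v‖ := by
      refine (norm_add_le _ _).trans ?_
      rw [norm_smul, norm_smul, Real.norm_of_nonneg ha, Real.norm_of_nonneg hb]
    have h2 := mul_le_mul_of_nonneg_left h1 hτ0
    rcases ha.eq_or_lt with rfl | ha'
    · have : b = 1 := by linarith
      subst this; simp at *; linarith
    · nlinarith [mul_lt_mul_of_pos_left hu ha', mul_le_mul_of_nonneg_left hv.le hb]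
  have hC0 : ∀ v ∈ C, v ≠ 0 := by
    rintro v hv rfl; simp [C] at hv
  let n : E3 → Sph := fun v => if h : v ≠ 0 then ⟨‖v‖⁻¹ • v, by
    simp [norm_smul, h]⟩ else q
  have hn : ∀ v ≠ 0, (n v : E3) = ‖v‖⁻¹ • v := by
    intro v hv; simp [n, hv]
  have hnc : ContinuousOn n C := by
    rw [Topology.IsInducing.subtypeVal.continuousOn_iff]
    refine ContinuousOn.congr (f := fun v => ‖v‖⁻¹ • v) ?_ (fun v hv => hn v (hC0 v hv))
    exact (continuous_norm.continuousOn.inv₀ fun v hv => norm_ne_zero_iff.2 (hC0 v hv)).smul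
      continuousOn_id
  have himg : n '' C = ball q ε := by
    have key : ∀ y : Sph, y ∈ ball q ε ↔ τ < inner ℝ (q : E3) (y : E3) := by
      intro y
      rw [mem_ball, ← sq_lt_sq₀ dist_nonneg hε.le, sph_dist_sq]
      constructor <;> intro h <;> linarith
    ext y
    constructor
    · rintro ⟨v, hv, rfl⟩
      have hv0 := hC0 v hv
      rw [key, hn v hv0, inner_smul_right]
      have : 0 < ‖v‖ := norm_pos_iff.2 hv0
      rw [inv_mul_eq_div, lt_div_iff₀ this]
      exact hv
    · intro hy
      refine ⟨y, ?_, ?_⟩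
      · simp only [C, mem_ofPred_eq, sph_norm, mul_one]; exact (key y).1 hy
      · apply Subtype.ext
        rw [hn _ (norm_ne_zero_iff.1 (by rw [sph_norm]; simp)), sph_norm]; simp
  rw [← himg]
  exact hC.isPreconnected.image n hnc

lemma log_exists {A : Type*} [NormedAddCommGroup A] [NormedSpace ℝ A] (g : A → ℂ)
    (hg : Continuous g) (h0 : ∀ x, g x ≠ 0) :
    ∃ L : A → ℂ, Continuous L ∧ ∀ x, Complex.exp (L x) = g x := by
  rcases Complex.isCoveringMapOn_exp.existsUnique_continuousMap_lifts
    (⟨g, hg⟩ : C(A, ℂ)) (a₀ := 0) (Complex.exp_log (h0 0)) (fun x ↦ h0 x) with ⟨f, ⟨-, hf⟩, -⟩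
  exact ⟨f, f.continuous, fun x => congrFun hf x⟩

lemma no_retract (H : ℂ → ℂ) (hH : Continuous H) (h0 : ∀ x, H x ≠ 0) (R : ℝ) (hR : 0 < R)
    (hid : ∀ x, R ≤ ‖x‖ → H x = x) : False := by
  obtain ⟨L, hL, hexp⟩ := log_exists H hH h0
  let φ : ℝ → ℂ := fun t => (L (R * Complex.exp (t * Complex.I)) - Real.log R - t * Complex.I) /
    (2 * Real.pi * Complex.I)
  have hφc : Continuous φ := by
    apply Continuous.div_const
    fun_prop
  have hnum : ∀ t, ∃ n : ℤ, φ t = n := by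
    intro t
    have h1 : Complex.exp (L (R * Complex.exp (t * Complex.I)))
        = Complex.exp (Real.log R + t * Complex.I) := by
      rw [hexp, hid _ (by simp [Complex.norm_exp_ofReal_mul_I, abs_of_pos hR]), Complex.exp_add]
      congr 1
      rw [← Complex.ofReal_exp, Real.exp_log hR]
    obtain ⟨n, hn⟩ := Complex.exp_eq_exp_iff_exists_int.1 h1
    refine ⟨n, ?_⟩
    simp only [φ]
    rw [hn]
    have : (2 * Real.pi * Complex.I : ℂ) ≠ 0 := Complex.two_pi_I_ne_zero
    field_simp
    ring
  choose n hn using hnum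
  have hnc : Continuous n := by
    have : Continuous (fun t => ((n t : ℝ))) := by
      have h2 : (fun t => ((n t : ℝ))) = fun t => (φ t).re := by
        funext t; rw [hn]; simp
      rw [h2]; fun_prop
    exact (Int.isClosedEmbedding_coe_real.isEmbedding.continuous_iff).2 this
  have hconst : n 0 = n (2 * Real.pi) :=
    PreconnectedSpace.constant inferInstance hnc
  have h3 : φ 0 = φ (2 * Real.pi) := by rw [hn, hn, hconst]
  simp only [φ] at h3
  have : (2 * Real.pi * Complex.I : ℂ) ≠ 0 := Complex.two_pi_I_ne_zero
  rw [div_left_inj' this] at h3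
  push_cast at h3
  rw [Complex.exp_two_pi_mul_I] at h3
  simp at h3
  have h4 := congrArg Complex.im h3
  simp only [Complex.sub_im, Complex.ofReal_im] at h4
  simp at h4
  linarith [Real.pi_pos]

lemma no_retract_open (N : Set ℂ) (h0 : (0:ℂ) ∈ N) (R : ℝ) (hR : 0 < R)
    (hNR : N ⊆ ball 0 R) (F : ℂ → ℂ) (hF : ContinuousOn F (closure N))
    (hF0 : ∀ x ∈ closure N, F x ≠ 0) (hfr : ∀ x ∈ frontier N, ‖F x - x‖ < ‖x‖) : False := by
  classical
  have hne : ∀ x ∈ frontier N, x ≠ 0 := by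
    rintro x hx rfl
    simpa using (norm_nonneg _).trans_lt (hfr 0 hx)
  have hsub : frontier N ⊆ closure N := frontier_subset_closure
  have hc : ContinuousOn (fun x => Complex.log (F x / x)) (frontier N) := by
    apply ContinuousOn.clog
    · exact (hF.mono hsub).div continuousOn_id hne
    · intro x hx
      suffices h : ‖F x / x - 1‖ < 1 by
        simpa using Complex.mem_slitPlane_of_norm_lt_one (z := F x / x - 1) h
      have hx0 := hne x hx
      have : F x / x - 1 = (F x - x) / x := by field_simp
      rw [this, norm_div, div_lt_one (norm_pos_iff.2 hx0)]
      exact hfr x hx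
  obtain ⟨l, hl⟩ := ContinuousMap.exists_restrict_eq (isClosed_frontier (s := N))
    ⟨_, continuousOn_iff_continuous_domRestrict.1 hc⟩
  have hl' : ∀ x ∈ frontier N, l x = Complex.log (F x / x) := fun x hx => DFunLike.congr_fun hl ⟨x, hx⟩
  apply no_retract (N.piecewise (fun x => F x * Complex.exp (- l x)) id) _ _ R hR _
  · rw [← continuousOn_univ]
    apply ContinuousOn.piecewise
    · rintro x ⟨-, hx⟩
      have hx0 := hne x hx
      have hFx := hF0 x (hsub hx)
      rw [hl' x hx, Complex.exp_neg, Complex.exp_log (div_ne_zero hFx hx0)]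
      simp
      field_simp
    · rw [univ_inter]
      exact hF.mul (by fun_prop)
    · exact continuousOn_id
  · intro x
    by_cases hx : x ∈ N
    · simp [hx, hF0 x (subset_closure hx)]
    · simp only [hx, not_false_eq_true, piecewise_eq_of_notMem, id]
      rintro rfl; exact hx h0
  · intro x hx
    have : x ∉ N := fun h => by
      have := hNR h
      simp at this; linarith
    simp [this]

lemma smooth_approx (G : EuclideanSpace ℝ (Fin 3) → ℂ) (hG : Continuous G) (m : ℝ) (hm : 0 < m) :
    ∃ P : EuclideanSpace ℝ (Fin 3) → ℂ, ContDiff ℝ 1 P ∧ ∀ x, dist (P x) (G x) < m := by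
  obtain ⟨P, hP⟩ := exists_contMDiffMap_forall_mem_convex_of_local_const (n := 1)
    (modelWithCornersSelf ℝ (EuclideanSpace ℝ (Fin 3))) (F := ℂ)
    (t := fun x => ball (G x) m) (fun x => convex_ball _ _) (fun x => ⟨G x, by
      have := hG.continuousAt (x := x) (ball_mem_nhds _ hm)
      filter_upwards [this] with y hy
      rw [mem_ball_comm]; exact hy⟩)
  exact ⟨P, P.contMDiff.contDiff, hP⟩

lemma generic_avoid (γ : ℕ → ℝ → ℂ) (h : ∀ i, ContDiff ℝ 1 (γ i)) (m : ℝ) (hm : 0 < m) :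
    ∃ v : ℂ, ‖v‖ < m ∧ ∀ i t, γ i t ≠ v := by
  have hd : dimH (⋃ i, range (γ i)) < Module.finrank ℝ ℂ := by
    rw [dimH_iUnion]
    refine lt_of_le_of_lt (iSup_le fun i => (h i).dimH_range_le) ?_
    simp
  obtain ⟨v, hv, hv2⟩ := (dense_compl_of_dimH_lt_finrank hd).exists_dist_lt 0 hm
  refine ⟨v, by simpa using hv2, fun i t he => hv (mem_iUnion.2 ⟨i, t, he⟩)⟩


lemma finite_big (c : ℕ → Sph) (r : ℕ → ℝ)
    (hdis : Pairwise fun i j => Disjoint (ball (c i) (r i)) (ball (c j) (r j)))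
    (δ : ℝ) (hδ : 0 < δ) : {k | δ ≤ r k}.Finite := by
  obtain ⟨t, -, htf, ht⟩ := finite_cover_balls_of_compact (isCompact_univ (X := Sph)) (half_pos hδ)
  have h1 : ∀ k, ∃ y ∈ t, dist (c k) y < δ / 2 := by
    intro k
    have := ht (mem_univ (c k))
    simpa using this
  choose f hft hf using h1
  refine Set.Finite.of_finite_image (f := f) (htf.subset (by rintro _ ⟨k, -, rfl⟩; exact hft k)) ?_
  intro i hi j hj hij
  by_contra hne
  have hi' : δ ≤ r i := hi
  have hj' : δ ≤ r j := hj
  refine Set.disjoint_left.1 (hdis hne) (mem_ball_self (lt_of_lt_of_le hδ hi)) ?_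
  have h1 := hf i
  have h2 := hf j
  rw [hij] at h1
  rw [mem_ball]
  linarith [dist_triangle_right (c i) (c j) (f j)]

lemma log_on_sphere (c z : Sph) (P : E3 → ℂ) (hP : Continuous P)
    (h0 : ∀ y : Sph, dist y c = dist z c → P y ≠ 0) (A : Set Sph) (hA : IsClosed A)
    (hAs : A ⊆ {y | dist y c = dist z c} \ {z}) :
    ∃ l : Sph → ℂ, Continuous l ∧ ∀ y ∈ A, Complex.exp (l y) = P y := by
  obtain ⟨γ, θ, hγ, hγs, hγθ, hθ⟩ := circle_param c z
  obtain ⟨L, hL, hexp⟩ := log_exists (fun t => P (γ t)) (hP.comp hγ.continuous) (by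
    intro t
    obtain ⟨y, hy, hyd⟩ := hγs t
    rw [← hy]; exact h0 y hyd)
  have hc : ContinuousOn (fun y => L (θ y)) A := hL.comp_continuousOn (hθ.mono hAs)
  obtain ⟨l, hl⟩ := ContinuousMap.exists_restrict_eq hA
    ⟨_, continuousOn_iff_continuous_domRestrict.1 hc⟩
  refine ⟨l, l.continuous, fun y hy => ?_⟩
  have : l y = L (θ y) := DFunLike.congr_fun hl ⟨y, hy⟩
  rw [this, hexp, hγθ y (hAs hy).1]

lemma patch (U : ℕ → Set Sph) (hopen : ∀ i, IsOpen (U i))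
    (hdisj : Pairwise fun i j => Disjoint (closure (U i)) (closure (U j)))
    (B : Set Sph) (p : Sph → ℂ) (hp : Continuous p) (J : Finset ℕ)
    (hlog : ∀ k ∈ J, ∃ l : Sph → ℂ, Continuous l ∧
      ∀ y ∈ frontier (U k), y ∉ B → Complex.exp (l y) = p y) :
    ∃ Q : Sph → ℂ, ContinuousOn Q Bᶜ ∧ (∀ y, (∀ k ∈ J, y ∉ U k) → Q y = p y) ∧
      (∀ k ∈ J, ∀ y ∈ U k, Q y ≠ 0) := by
  classical
  induction J using Finset.induction_on with
  | empty => exact ⟨p, hp.continuousOn, fun _ _ => rfl, by simp⟩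
  | insert k J hk ih =>
    obtain ⟨Q, hQ, hQp, hQ0⟩ := ih (fun j hj => hlog j (Finset.mem_insert_of_mem hj))
    obtain ⟨l, hl, hlp⟩ := hlog k (Finset.mem_insert_self _ _)
    refine ⟨(U k).piecewise (fun y => Complex.exp (l y)) Q, ?_, ?_, ?_⟩
    · apply ContinuousOn.piecewise
      · rintro y ⟨hyB, hy⟩
        rw [hlp y hy hyB, hQp]
        intro j hj hyj
        have hne : j ≠ k := by rintro rfl; exact hk hj
        exact Set.disjoint_left.1 (hdisj hne) (subset_closure hyj) (frontier_subset_closure hy)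
      · exact hl.cexp.continuousOn
      · exact hQ.mono inter_subset_left
    · intro y hy
      have h1 : y ∉ U k := hy k (Finset.mem_insert_self _ _)
      simp only [h1, not_false_eq_true, piecewise_eq_of_notMem]
      exact hQp y fun j hj => hy j (Finset.mem_insert_of_mem hj)
    · intro j hj y hy
      by_cases h1 : y ∈ U k
      · simp [h1]
      · simp only [h1, not_false_eq_true, piecewise_eq_of_notMem]
        rcases Finset.mem_insert.1 hj with rfl | hj
        · exact absurd hy h1
        · exact hQ0 j hj y hy

/-- A map of a disc, injective over the carpet, covers a neighbourhood of the image of the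
centre as soon as this image lies off all the closed peripheral discs. -/
lemma core (U : ℕ → Set Sph) (c : ℕ → Sph) (r : ℕ → ℝ)
    (hr : ∀ i, 0 < r i) (hball : ∀ i, U i = Metric.ball (c i) (r i))
    (hdisj : Pairwise fun i j => Disjoint (closure (U i)) (closure (U j)))
    (f : ℂ → Sph) (R : ℝ) (hR : 0 < R) (hf : ContinuousOn f (closedBall 0 R))
    (hinj : InjOn f (closedBall 0 R ∩ f ⁻¹' (⋃ i, U i)ᶜ))
    (hq : f 0 ∉ ⋃ i, closure (U i)) :
    ∃ ε > 0, ball (f 0) ε ⊆ f '' closedBall 0 R := by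
  classical
  by_contra hcon
  push Not at hcon
  have hopen : ∀ i, IsOpen (U i) := fun i => by rw [hball]; exact isOpen_ball
  have hdU : Pairwise fun i j => Disjoint (U i) (U j) :=
    fun i j h => (hdisj h).mono subset_closure subset_closure
  have hdis : Pairwise fun i j => Disjoint (ball (c i) (r i)) (ball (c j) (r j)) := by
    intro i j h
    rw [← hball, ← hball]; exact hdU h
  have hfin := finite_big c r hdis
  set q := f 0 with hqdef
  have hq' : ∀ i, q ∉ closure (U i) := fun i h => hq (mem_iUnion.2 ⟨i, h⟩)
  have h0D : (0 : ℂ) ∈ closedBall (0 : ℂ) R := by simp [hR.le]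
  have hqI : q ∈ (⋃ i, U i)ᶜ := fun h => by
    obtain ⟨i, hi⟩ := mem_iUnion.1 h
    exact hq' i (subset_closure hi)
  set K : Set ℂ := closedBall 0 R ∩ f ⁻¹' (⋃ i, U i)ᶜ with hK
  have hKc : IsCompact K := by
    refine (isCompact_closedBall (0 : ℂ) R).of_isClosed_subset ?_ inter_subset_left
    exact hf.preimage_isClosed_of_isClosed isClosed_closedBall
      (isOpen_iUnion hopen).isClosed_compl
  have hDc : IsCompact (f '' closedBall 0 R) := (isCompact_closedBall (0 : ℂ) R).image_of_continuousOn hf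
  have hSc : IsCompact (f '' sphere 0 R) :=
    (isCompact_sphere (0 : ℂ) R).image_of_continuousOn (hf.mono sphere_subset_closedBall)
  have hqS : q ∉ f '' sphere 0 R := by
    rintro ⟨x, hx, hxq⟩
    have hxK : x ∈ K := ⟨sphere_subset_closedBall hx, by rw [mem_preimage, hxq]; exact hqI⟩
    have : x = 0 := hinj hxK ⟨h0D, hqI⟩ hxq
    subst this
    simp at hx; linarith
  obtain ⟨d, hd, hdS⟩ : ∃ d > 0, ball q d ⊆ (f '' sphere 0 R)ᶜ :=
    Metric.isOpen_iff.1 hSc.isClosed.isOpen_compl q hqS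
  -- choice of `ε`
  obtain ⟨ε, hε, hε1, hεd, hεU⟩ : ∃ ε > 0, ε ≤ 1 ∧ 8 * ε ≤ d ∧
      ∀ k, d / 8 ≤ r k → Disjoint (ball q (2 * ε)) (U k) := by
    have hcl : IsClosed (⋃ k ∈ {k | d / 8 ≤ r k}, closure (U k)) :=
      (hfin (d / 8) (by positivity)).isClosed_biUnion (fun i _ => isClosed_closure)
    have hqn : q ∈ (⋃ k ∈ {k | d / 8 ≤ r k}, closure (U k))ᶜ := by
      simp only [mem_compl_iff, mem_iUnion, not_exists]
      exact fun i _ => hq' i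
    obtain ⟨η, hη, hηs⟩ := Metric.isOpen_iff.1 hcl.isOpen_compl q hqn
    refine ⟨min (η / 2) (min 1 (d / 8)), by positivity, ?_, ?_, ?_⟩
    · exact (min_le_right _ _).trans (min_le_left _ _)
    · have : min (η / 2) (min 1 (d / 8)) ≤ d / 8 := (min_le_right _ _).trans (min_le_right _ _)
      linarith
    · intro k hk
      rw [Set.disjoint_left]
      intro y hy hyk
      have h1 : min (η / 2) (min 1 (d / 8)) ≤ η / 2 := min_le_left _ _
      have h2 : y ∈ ball q η := ball_subset_ball (by linarith) hy
      exact hηs h2 (mem_iUnion₂.2 ⟨k, hk, subset_closure hyk⟩)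
  obtain ⟨q₁, hq₁, hq₁n⟩ := Set.not_subset.1 (hcon ε hε)
  set B : Set Sph := ball q₁ ε with hB
  have hqB : q ∈ B := by rw [hB, mem_ball_comm]; exact hq₁
  have hB2 : B ⊆ ball q (2 * ε) := by
    intro y hy
    rw [hB, mem_ball] at hy
    rw [mem_ball] at hq₁ ⊢
    linarith [dist_triangle y q₁ q]
  set Bh : Set Sph := B ∪ ⋃ k ∈ {k | (U k ∩ B).Nonempty}, U k with hBh
  have hBho : IsOpen Bh := isOpen_ball.union (isOpen_biUnion fun i _ => hopen i)
  have hBhd : Bh ⊆ ball q d := by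
    rintro y (hy | hy)
    · exact ball_subset_ball (by linarith) (hB2 hy)
    · obtain ⟨k, ⟨b, hbk, hbB⟩, hyk⟩ := mem_iUnion₂.1 hy
      have hrk : r k < d / 8 := by
        by_contra hh
        exact Set.disjoint_left.1 (hεU k (not_lt.1 hh)) (hB2 hbB) hbk
      have h1 := hB2 hbB
      rw [hball, mem_ball] at hbk hyk
      rw [mem_ball] at h1 ⊢
      linarith [dist_triangle y (c k) q, dist_triangle_left (c k) q b]
  have hUBh : ∀ y ∈ closure Bh, y ∉ Bh → y ∈ (⋃ i, U i)ᶜ := by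
    intro y hy hyn hyU
    obtain ⟨j, hj⟩ := mem_iUnion.1 hyU
    obtain ⟨w, hwj, hw⟩ := mem_closure_iff.1 hy (U j) (hopen j) hj
    apply hyn
    rcases hw with hw | hw
    · exact Or.inr (mem_iUnion₂.2 ⟨j, ⟨w, hwj, hw⟩, hj⟩)
    · obtain ⟨k, hk, hwk⟩ := mem_iUnion₂.1 hw
      have : j = k := by
        by_contra hne
        exact Set.disjoint_left.1 (hdU hne) hwj hwk
      subst this
      exact Or.inr (mem_iUnion₂.2 ⟨j, hk, hj⟩)
  -- the open set `N` in the source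
  set N : Set ℂ := closedBall 0 R ∩ f ⁻¹' Bh with hN
  have hNball : N = ball 0 R ∩ f ⁻¹' Bh := by
    apply subset_antisymm
    · rintro x ⟨hx, hxB⟩
      refine ⟨?_, hxB⟩
      rw [mem_closedBall] at hx
      rw [mem_ball]
      refine lt_of_le_of_ne hx fun h => ?_
      exact hdS (hBhd hxB) ⟨x, h, rfl⟩
    · exact inter_subset_inter_left _ ball_subset_closedBall
  have hNo : IsOpen N := by
    rw [hNball]
    exact (hf.mono ball_subset_closedBall).isOpen_inter_preimage isOpen_ball hBho
  have h0N : (0 : ℂ) ∈ N := ⟨h0D, Or.inl hqB⟩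
  have hNcl : closure N ⊆ closedBall 0 R := closure_minimal inter_subset_left isClosed_closedBall
  have hfr : ∀ x ∈ frontier N, x ∈ K ∧ f x ∉ Bh := by
    intro x hx
    have hxc := hNcl (frontier_subset_closure hx)
    have hxn : f x ∉ Bh := by
      intro h
      rw [hNo.frontier_eq] at hx
      exact hx.2 ⟨hxc, h⟩
    refine ⟨⟨hxc, hUBh _ ?_ hxn⟩, hxn⟩
    have h1 : ContinuousWithinAt f N x := (hf x hxc).mono inter_subset_left
    exact closure_mono (by rintro _ ⟨w, hw, rfl⟩; exact hw.2)
      (h1.mem_closure_image (frontier_subset_closure hx))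
  -- the inverse, extended and smoothed
  have hemb : Topology.IsClosedEmbedding (fun x : K => (f x : E3)) := by
    haveI : CompactSpace K := isCompact_iff_compactSpace.1 hKc
    apply Continuous.isClosedEmbedding
    · exact continuous_subtype_val.comp
        (continuousOn_iff_continuous_domRestrict.1 (hf.mono inter_subset_left))
    · intro x y hxy
      exact Subtype.ext (hinj x.2 y.2 (Subtype.ext hxy))
  obtain ⟨G, hG⟩ := ContinuousMap.exists_extension' hemb (⟨fun x : K => (x : ℂ), by fun_prop⟩ : C(K, ℂ))
  have hG' : ∀ x ∈ K, G (f x) = x := fun x hx => congrFun hG ⟨x, hx⟩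
  have hfrc : IsCompact (frontier N) :=
    (isCompact_closedBall (0 : ℂ) R).of_isClosed_subset isClosed_frontier
      (frontier_subset_closure.trans hNcl)
  obtain ⟨m, hm, hmN⟩ : ∃ m > 0, ∀ x ∈ frontier N, m ≤ ‖x‖ := by
    have h0f : (0 : ℂ) ∈ (frontier N)ᶜ := by
      rw [hNo.frontier_eq]; exact fun h => h.2 h0N
    obtain ⟨m, hm, hms⟩ := Metric.isOpen_iff.1 isClosed_frontier.isOpen_compl _ h0f
    refine ⟨m, hm, fun x hx => ?_⟩
    by_contra hlt
    exact hms (by simpa using hlt) hx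
  obtain ⟨P₀, hP₀, hP₀G⟩ := smooth_approx G G.continuous (m / 2) (half_pos hm)
  have hpar : ∀ (a : Sph) (s : ℝ), ∃ γ : ℝ → E3, ContDiff ℝ 1 γ ∧
      ∀ y : Sph, dist y a = s → ∃ t, γ t = y := by
    intro a s
    by_cases h : ∃ z : Sph, dist z a = s
    · obtain ⟨z, rfl⟩ := h
      obtain ⟨γ, θ, h1, -, h2, -⟩ := circle_param a z
      exact ⟨γ, h1, fun y hy => ⟨_, h2 y hy⟩⟩
    · exact ⟨fun _ => 0, contDiff_const, fun y hy => absurd ⟨y, hy⟩ h⟩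
  choose γ hγ hγs using hpar
  obtain ⟨v, hvm, hv⟩ := generic_avoid
    (fun i t => P₀ (Nat.casesOn i (γ q₁ ε t) (fun k => γ (c k) (r k) t)))
    (by
      intro i
      cases i with
      | zero => exact hP₀.comp (hγ q₁ ε)
      | succ k => exact hP₀.comp (hγ (c k) (r k))) (m / 2) (half_pos hm)
  let P : E3 → ℂ := fun y => P₀ y - v
  have hPc : Continuous P := hP₀.continuous.sub continuous_const
  have hPΓ : ∀ y : Sph, dist y q₁ = ε → P y ≠ 0 := by
    intro y hy
    obtain ⟨t, ht⟩ := hγs q₁ ε y hy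
    have := hv 0 t
    simp only [ht] at this
    exact sub_ne_zero.2 this
  have hPk : ∀ k, ∀ y : Sph, dist y (c k) = r k → P y ≠ 0 := by
    intro k y hy
    obtain ⟨t, ht⟩ := hγs (c k) (r k) y hy
    have := hv (k + 1) t
    simp only [ht] at this
    exact sub_ne_zero.2 this
  have hPfr : ∀ x ∈ frontier N, ‖P (f x) - x‖ < ‖x‖ := by
    intro x hx
    have h1 := hP₀G (f x)
    rw [hG' x (hfr x hx).1, dist_eq_norm] at h1
    have h2 : P (f x) - x = (P₀ (f x) - x) - v := by simp only [P]; ring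
    rw [h2]
    linarith [norm_sub_le (P₀ (f x) - x) v, hmN x hx]
  -- thin collar of the circle without zeros
  obtain ⟨σ, hσ, hσP⟩ : ∃ σ > 0, ∀ y : Sph, ε ≤ dist y q₁ → dist y q₁ < ε + σ → P y ≠ 0 := by
    let Z : Set Sph := {y | P y = 0 ∧ ε ≤ dist y q₁}
    have hZ : IsCompact Z := by
      apply IsClosed.isCompact
      have h1 : IsClosed {y : Sph | P y = 0} := isClosed_eq (by fun_prop) continuous_const
      have h2 : IsClosed {y : Sph | ε ≤ dist y q₁} := isClosed_le continuous_const (by fun_prop)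
      exact h1.inter h2
    rcases Z.eq_empty_or_nonempty with h | h
    · refine ⟨1, one_pos, fun y hy _ h0 => ?_⟩
      have : y ∈ Z := ⟨h0, hy⟩
      rw [h] at this; exact this
    · obtain ⟨y₀, hy₀, hmin⟩ := hZ.exists_isMinOn h
        (f := fun y => dist y q₁) (by fun_prop)
      have hlt : ε < dist y₀ q₁ := lt_of_le_of_ne hy₀.2 fun h => hPΓ y₀ h.symm hy₀.1
      refine ⟨dist y₀ q₁ - ε, by linarith, fun y hy hy2 h0 => ?_⟩
      have : dist y₀ q₁ ≤ dist y q₁ := hmin (show y ∈ Z from ⟨h0, hy⟩)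
      linarith
  -- finitely many bad discs
  have hJf : {k | (U k ∩ B).Nonempty ∧ σ / 2 ≤ r k}.Finite :=
    (hfin (σ / 2) (half_pos hσ)).subset fun k hk => hk.2
  have hlog : ∀ k ∈ hJf.toFinset, ∃ l : Sph → ℂ, Continuous l ∧
      ∀ y ∈ frontier (U k), y ∉ B → Complex.exp (l y) = P y := by
    intro k hk
    rw [Set.Finite.mem_toFinset] at hk
    obtain ⟨⟨b, hbk, hbB⟩, -⟩ := hk
    have hfs : frontier (U k) ⊆ sphere (c k) (r k) := by
      rw [hball]; exact frontier_ball_subset_sphere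
    obtain ⟨z, hzB, hz⟩ : ∃ z ∈ B, dist z (c k) = r k := by
      have hpre := cap_preconnected q₁ ε hε hε1
      have hiv := hpre.intermediate_value hbB hqB
        (f := fun y => dist y (c k)) (by fun_prop)
      have h1 : dist b (c k) ≤ r k := by
        rw [hball, mem_ball] at hbk; exact hbk.le
      have h2 : r k ≤ dist q (c k) := by
        by_contra hh
        apply hq' k
        apply subset_closure
        rw [hball]; exact not_le.1 hh
      obtain ⟨z, hz, hz2⟩ := hiv ⟨h1, h2⟩
      exact ⟨z, hz, hz2⟩
    obtain ⟨l, hl, hlP⟩ := log_on_sphere (c k) z P hPc (fun y hy => hPk k y (hy.trans hz))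
      (frontier (U k) ∩ Bᶜ) (isClosed_frontier.inter isOpen_ball.isClosed_compl) (by
        rintro y ⟨hy, hyB⟩
        refine ⟨?_, ?_⟩
        · exact (hfs hy : dist y (c k) = r k).trans hz.symm
        · rintro rfl; exact hyB hzB)
    exact ⟨l, hl, fun y hy hyB => hlP y ⟨hy, hyB⟩⟩
  obtain ⟨Q, hQ, hQP, hQ0⟩ := patch U hopen hdisj B (fun y => P y) (by fun_prop) hJf.toFinset hlog
  obtain ⟨Φ, hΦ, hΦid, hΦB⟩ := radial_retract q₁ ε hε (by linarith)
  have hfq₁ : ∀ x ∈ closedBall (0 : ℂ) R, f x ≠ q₁ := fun x hx h => hq₁n ⟨x, hx, h⟩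
  have hΦmem : ∀ y ≠ q₁, Φ y ∈ Bᶜ := by
    intro y hy
    by_cases h : y ∈ B
    · have := hΦB y h hy
      rw [hB]; simp [this]
    · rw [hΦid y h]; exact h
  have hQfr : ∀ x ∈ frontier N, Q (Φ (f x)) = P (f x) := by
    intro x hx
    have h1 := (hfr x hx).2
    rw [hΦid _ (fun h => h1 (Or.inl h)), hQP]
    intro k hk hxk
    rw [Set.Finite.mem_toFinset] at hk
    exact h1 (Or.inr (mem_iUnion₂.2 ⟨k, hk.1, hxk⟩))
  refine no_retract_open N h0N R hR (by rw [hNball]; exact inter_subset_left)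
    (fun x => Q (Φ (f x))) ?_ ?_ ?_
  · refine hQ.comp (hΦ.comp (hf.mono hNcl) ?_) ?_
    · intro x hx; exact hfq₁ x (hNcl hx)
    · intro x hx; exact hΦmem _ (hfq₁ x (hNcl hx))
  · intro x hx
    have hxc := hNcl hx
    by_cases hxN : x ∈ N
    · have hgen : ∀ y : Sph, y ∉ B → ε ≤ dist y q₁ := fun y hy => not_lt.1 hy
      by_cases hxB : f x ∈ B
      · have h1 := hΦB _ hxB (hfq₁ x hxc)
        by_cases h2 : ∃ k ∈ hJf.toFinset, Φ (f x) ∈ U k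
        · obtain ⟨k, hk, h2⟩ := h2
          exact hQ0 k hk _ h2
        · push Not at h2
          show Q (Φ (f x)) ≠ 0
          rw [hQP _ h2]
          exact hPΓ _ h1
      · show Q (Φ (f x)) ≠ 0
        rw [hΦid _ hxB]
        rcases hxN.2 with h | h
        · exact absurd h hxB
        obtain ⟨k, hk, hxk⟩ := mem_iUnion₂.1 h
        by_cases hbig : σ / 2 ≤ r k
        · exact hQ0 k (by rw [Set.Finite.mem_toFinset]; exact ⟨hk, hbig⟩) _ hxk
        · by_cases h2 : ∃ j ∈ hJf.toFinset, f x ∈ U j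
          · obtain ⟨j, hj, h2⟩ := h2
            exact hQ0 j hj _ h2
          · push Not at h2
            rw [hQP _ h2]
            apply hσP _ (hgen _ hxB)
            obtain ⟨b, hbk, hbB⟩ := hk
            rw [hball, mem_ball] at hbk hxk
            rw [hB, mem_ball] at hbB
            push Not at hbig
            linarith [dist_triangle (f x) b q₁, dist_triangle_right (f x) b (c k)]
    · have hxf : x ∈ frontier N := by rw [hNo.frontier_eq]; exact ⟨hx, hxN⟩
      show Q (Φ (f x)) ≠ 0
      rw [hQfr x hxf]
      intro h0
      have := hPfr x hxf
      rw [h0] at this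
      simp at this
  · intro x hx
    show ‖Q (Φ (f x)) - x‖ < ‖x‖
    rw [hQfr x hx]
    exact hPfr x hx

/-- **Spine image claim.**  Let `(Uᵢ)` be a countable family of nonempty open round disks in
`S²` with pairwise disjoint closures and dense union, and `I* = S² \ ⋃ᵢ Uᵢ`.  If
`g : T × [0,1] → S²` is continuous, injective on `g⁻¹(I*)`, and sends some point `(o,s)` of the
open spine outside `⋃ᵢ closure (Uᵢ)`, then the image of the open spine is contained in `I*`. -/
theorem spine_image_in_carpet
    (U : ℕ → Set Sph) (c : ℕ → Sph) (r : ℕ → ℝ)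
    (hr : ∀ i, 0 < r i) (hball : ∀ i, U i = Metric.ball (c i) (r i))
    (hne : ∀ i, (U i).Nonempty)
    (hdisj : Pairwise fun i j => Disjoint (closure (U i)) (closure (U j)))
    (hdense : Dense (⋃ i, U i))
    (g : (ℝ × ℝ) × ℝ → Sph)
    (hg : ContinuousOn g (tripod ×ˢ Icc (0 : ℝ) 1))
    (hinj : InjOn g ((tripod ×ˢ Icc (0 : ℝ) 1) ∩ g ⁻¹' (⋃ i, U i)ᶜ))
    (s : ℝ) (hs : s ∈ Ioo (0 : ℝ) 1)
    (hgs : g ((0 : ℝ × ℝ), s) ∉ ⋃ i, closure (U i)) :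
    g '' (({(0 : ℝ × ℝ)} : Set (ℝ × ℝ)) ×ˢ Ioo (0 : ℝ) 1) ⊆ (⋃ i, U i)ᶜ := by
  exfalso
  have h3 : 0 < Real.sqrt 3 := Real.sqrt_pos.mpr (by norm_num)
  have hopen : ∀ i, IsOpen (U i) := fun i => by rw [hball]; exact isOpen_ball
  obtain ⟨hs0, hs1⟩ := hs
  set R : ℝ := min s (1 - s) with hRdef
  have hR : 0 < R := lt_min hs0 (by linarith)
  have hRs : R ≤ s := min_le_left _ _
  have hRs' : R ≤ 1 - s := min_le_right _ _
  set ψ : ℂ → (ℝ × ℝ) × ℝ := fun z =>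
    ((max z.re 0 - max (-z.re) 0 / 2, max (-z.re) 0 * (Real.sqrt 3 / 2)), s + z.im) with hψ
  have hψc : Continuous ψ := by
    rw [hψ]
    fun_prop
  have hbd : ∀ z ∈ closedBall (0 : ℂ) R, |z.re| ≤ R ∧ |z.im| ≤ R := by
    intro z hz
    rw [mem_closedBall, dist_zero_right] at hz
    exact ⟨(Complex.abs_re_le_norm z).trans hz, (Complex.abs_im_le_norm z).trans hz⟩
  have hψm : MapsTo ψ (closedBall 0 R) (tripod ×ˢ Icc (0 : ℝ) 1) := by
    intro z hz
    obtain ⟨h1, h2⟩ := hbd z hz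
    rw [abs_le] at h1 h2
    refine ⟨?_, ?_, ?_⟩
    · left
      rcases le_total 0 z.re with h | h
      · left
        refine ⟨1 - z.re, z.re, by linarith, h, by ring, ?_⟩
        simp [hψ, max_eq_left h, max_eq_right (neg_nonpos.mpr h)]
      · right
        refine ⟨1 + z.re, -z.re, by linarith, by linarith, by ring, ?_⟩
        have : max (-z.re) 0 = -z.re := max_eq_left (by linarith)
        simp only [hψ, max_eq_right h, this]
        ext <;> simp <;> ring
    · simp only [hψ]; linarith
    · simp only [hψ]; linarith
  have hψinj : InjOn ψ (closedBall 0 R) := by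
    intro z _ w _ hzw
    simp only [hψ, Prod.mk.injEq] at hzw
    obtain ⟨⟨h1, h2⟩, h4⟩ := hzw
    have h5 : max (-z.re) 0 = max (-w.re) 0 := mul_right_cancel₀ (by positivity) h2
    have h6 : max z.re 0 = max w.re 0 := by rw [h5] at h1; linarith
    have e : ∀ x : ℝ, x = max x 0 - max (-x) 0 := by
      intro x
      rcases le_total 0 x with h | h
      · rw [max_eq_left h, max_eq_right (by linarith)]; ring
      · rw [max_eq_right h, max_eq_left (by linarith)]; ring
    apply Complex.ext
    · rw [e z.re, e w.re, h5, h6]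
    · linarith
  have hψ0 : ψ 0 = ((0 : ℝ × ℝ), s) := by
    simp [hψ]
  obtain ⟨ε, hε, hsub⟩ := core U c r hr hball hdisj (g ∘ ψ) R hR
    (hg.comp hψc.continuousOn hψm)
    (by
      intro z hz w hw h
      exact hψinj hz.1 hw.1 (hinj ⟨hψm hz.1, hz.2⟩ ⟨hψm hw.1, hw.2⟩ h))
    (by simpa [hψ0] using hgs)
  rw [Function.comp_apply, hψ0] at hsub
  -- the third page
  set φ : ℝ × ℝ → (ℝ × ℝ) × ℝ := fun p =>
    ((-(p.1 / 2), -(p.1 * (Real.sqrt 3 / 2))), s + p.2) with hφ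
  have hφc : Continuous φ := by
    rw [hφ]
    fun_prop
  have hφ0 : φ 0 = ((0 : ℝ × ℝ), s) := by simp [hφ]
  set Q : Set (ℝ × ℝ) := Icc 0 R ×ˢ Icc (-R) R with hQ
  have hφm : MapsTo φ Q (tripod ×ˢ Icc (0 : ℝ) 1) := by
    rintro ⟨u, v⟩ ⟨⟨h1, h2⟩, h4, h5⟩
    simp only at h1 h2 h4 h5
    refine ⟨?_, ?_, ?_⟩
    · right
      refine ⟨1 - u, u, by linarith, h1, by ring, ?_⟩
      simp only [hφ]
      ext <;> simp <;> ring
    · simp only [hφ]; linarith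
    · simp only [hφ]; linarith
  have hgφ : ContinuousOn (g ∘ φ) Q := hg.comp hφc.continuousOn hφm
  have h0Q : (0 : ℝ × ℝ) ∈ Q := by
    refine ⟨⟨le_refl _, hR.le⟩, ?_, ?_⟩ <;> simp [hR.le]
  obtain ⟨d, hd, hdball⟩ := Metric.continuousWithinAt_iff.mp (hgφ 0 h0Q) ε hε
  set δ : ℝ := min d R with hδdef
  have hδ : 0 < δ := lt_min hd hR
  have hδd : δ ≤ d := min_le_left _ _
  have hδR : δ ≤ R := min_le_right _ _
  set S : Set (ℝ × ℝ) := Ioo 0 δ ×ˢ Ioo (-δ) δ with hS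
  have hSQ : S ⊆ Q := by
    rintro ⟨u, v⟩ ⟨⟨h1, h2⟩, h4, h5⟩
    simp only at h1 h2 h4 h5
    refine ⟨⟨?_, ?_⟩, ?_, ?_⟩ <;> simp only <;> linarith
  have hSball : ∀ p ∈ S, g (φ p) ∈ ball (g ((0 : ℝ × ℝ), s)) ε := by
    rintro ⟨u, v⟩ hp
    have hQp := hSQ hp
    obtain ⟨⟨h1, h2⟩, h4, h5⟩ := hp
    simp only at h1 h2 h4 h5
    have := hdball hQp (by
      rw [dist_zero_right, Prod.norm_def, max_lt_iff, Real.norm_eq_abs, Real.norm_eq_abs,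
        abs_lt, abs_lt]
      refine ⟨⟨?_, ?_⟩, ?_, ?_⟩ <;> simp only <;> linarith)
    simpa [hφ0] using this
  have hSU : ∀ p ∈ S, g (φ p) ∈ ⋃ i, U i := by
    intro p hp
    by_contra hn
    obtain ⟨z, hz, hzp⟩ := hsub (hSball p hp)
    rw [Function.comp_apply] at hzp
    have heq : ψ z = φ p := hinj ⟨hψm hz, by rw [mem_preimage, hzp]; exact hn⟩
      ⟨hφm (hSQ hp), hn⟩ hzp
    have hp1 : 0 < p.1 := hp.1.1
    simp only [hψ, hφ, Prod.mk.injEq] at heq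
    have h2 := heq.1.2
    have h6 : 0 ≤ max (-z.re) 0 * (Real.sqrt 3 / 2) := by positivity
    have h7 : 0 < p.1 * (Real.sqrt 3 / 2) := by positivity
    linarith
  have hSconn : IsPreconnected S := isPreconnected_Ioo.prod isPreconnected_Ioo
  have himg : IsPreconnected ((g ∘ φ) '' S) := hSconn.image _ (hgφ.mono hSQ)
  have hpt : ((δ / 2, 0) : ℝ × ℝ) ∈ S := by
    refine ⟨⟨?_, ?_⟩, ?_, ?_⟩ <;> simp only <;> linarith
  obtain ⟨k, hk⟩ := mem_iUnion.mp (hSU _ hpt)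
  have hin : (g ∘ φ) '' S ⊆ U k := by
    apply himg.subset_left_of_subset_union (hopen k)
      (isOpen_iUnion fun j => isOpen_iUnion fun (_ : j ≠ k) => hopen j)
    · rw [disjoint_iUnion_right]
      intro j
      rw [disjoint_iUnion_right]
      intro hj
      exact (hdisj hj.symm).mono subset_closure subset_closure
    · rintro _ ⟨p, hp, rfl⟩
      obtain ⟨j, hj⟩ := mem_iUnion.mp (hSU p hp)
      by_cases h : j = k
      · left; subst h; exact hj
      · right
        exact mem_iUnion.mpr ⟨j, mem_iUnion.mpr ⟨h, hj⟩⟩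
    · exact ⟨_, ⟨_, hpt, rfl⟩, hk⟩
  have h0S : (0 : ℝ × ℝ) ∈ closure S := by
    rw [hS, closure_prod_eq, closure_Ioo hδ.ne, closure_Ioo (show -δ ≠ δ by intro h; linarith)]
    refine ⟨⟨le_refl _, hδ.le⟩, ?_, ?_⟩ <;> simp [hδ.le]
  apply hgs
  refine mem_iUnion.mpr ⟨k, ?_⟩
  have := ((hgφ 0 h0Q).mono hSQ).mem_closure_image h0S
  rw [Function.comp_apply, hφ0] at this
  exact closure_mono hin this
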